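/- Let X be a σ-compact locally compact Hausdorff space and let κ be a positive definite kernel on X (i.e., 2κ(μ,ν) ≤ κ(μ,μ) + κ(ν,ν) for all μ,ν ∈ E⁺). If κ satisfies (A2), then κ is strictly positive definite: whenever μ, ν ∈ E⁺ satisfy κ(μ,μ) − 2κ(μ,ν) + κ(ν,ν) = 0, it follows that μ = ν. -/

import Mathlib

open MeasureTheory Filter Topology Set
open scoped ENNReal NNReal

namespace Balayage

variable {X : Type*} [TopologicalSpace X] [T2Space X] [LocallyCompactSpace X]
  [MeasurableSpace X] [BorelSpace X]

/-- The potential `κμ(x) := ∫ κ(x,y) dμ(y)`. -/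
noncomputable def pot (κ : X → X → ℝ≥0∞) (μ : Measure X) (x : X) : ℝ≥0∞ :=
  ∫⁻ y, κ x y ∂μ

/-- The mutual energy `κ(μ,ν) := ∬ κ(x,y) d(μ⊗ν)(x,y)`. -/
noncomputable def energy (κ : X → X → ℝ≥0∞) (μ ν : Measure X) : ℝ≥0∞ :=
  ∫⁻ x, pot κ ν x ∂μ

/-- A positive Radon measure: locally finite and inner regular. -/
def IsRadon (μ : Measure X) : Prop :=
  μ.InnerRegular ∧ IsLocallyFiniteMeasure μ

/-- `E⁺`: the positive Radon measures of finite energy. -/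
def Eplus (κ : X → X → ℝ≥0∞) : Set (Measure X) :=
  {μ | IsRadon μ ∧ energy κ μ μ < ⊤}

/-- `μ` is concentrated on `A`: `A` is `μ`-measurable and `X∖A` is locally `μ`-negligible. -/
def ConcOn (μ : Measure X) (A : Set X) : Prop :=
  NullMeasurableSet A μ ∧ ∀ K : Set X, IsCompact K → μ (Aᶜ ∩ K) = 0

/-- `E⁺_A`: measures of finite energy concentrated on `A`. -/
def EplusOn (κ : X → X → ℝ≥0∞) (A : Set X) : Set (Measure X) :=
  {μ ∈ Eplus κ | ConcOn μ A}

/-- The inner capacity `c_*(A)`. -/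
noncomputable def innerCap (κ : X → X → ℝ≥0∞) (A : Set X) : ℝ≥0∞ :=
  (⨅ μ ∈ {μ ∈ EplusOn κ A | μ Set.univ = 1}, energy κ μ μ)⁻¹

/-- `P` holds nearly everywhere on `A`: the set where it fails has inner capacity zero. -/
def NEOn (κ : X → X → ℝ≥0∞) (A : Set X) (P : X → Prop) : Prop :=
  innerCap κ {x | x ∈ A ∧ ¬ P x} = 0

/-- The outer capacity `c^*(A)`. -/
noncomputable def outerCap (κ : X → X → ℝ≥0∞) (A : Set X) : ℝ≥0∞ :=
  ⨅ D ∈ {D : Set X | IsOpen D ∧ A ⊆ D}, innerCap κ D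

/-- `P` holds quasi-everywhere on `A`: the set where it fails has outer capacity zero. -/
def QEOn (κ : X → X → ℝ≥0∞) (A : Set X) (P : X → Prop) : Prop :=
  outerCap κ {x | x ∈ A ∧ ¬ P x} = 0

/-- The class `Λ_{A,μ}` of measures `ν ∈ E⁺` with `κν ≥ κμ` n.e. on `A`. -/
def InnerLam (κ : X → X → ℝ≥0∞) (A : Set X) (μ : Measure X) : Set (Measure X) :=
  {ν ∈ Eplus κ | NEOn κ A (fun x => pot κ μ x ≤ pot κ ν x)}

/-- The class `Λ*_{A,μ}` of measures `ν ∈ E⁺` with `κν ≥ κμ` q.e. on `A`. -/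
def OuterLam (κ : X → X → ℝ≥0∞) (A : Set X) (μ : Measure X) : Set (Measure X) :=
  {ν ∈ Eplus κ | QEOn κ A (fun x => pot κ μ x ≤ pot κ ν x)}

/-- `b` is the inner balayage `μ^A`: the measure of minimal potential in `Λ_{A,μ}`. -/
def IsInnerBal (κ : X → X → ℝ≥0∞) (A : Set X) (μ b : Measure X) : Prop :=
  b ∈ InnerLam κ A μ ∧ ∀ ν ∈ InnerLam κ A μ, ∀ x, pot κ b x ≤ pot κ ν x

/-- `b` is the outer balayage `μ^{*A}`: the measure of minimal potential in `Λ*_{A,μ}`. -/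
def IsOuterBal (κ : X → X → ℝ≥0∞) (A : Set X) (μ b : Measure X) : Prop :=
  b ∈ OuterLam κ A μ ∧ ∀ ν ∈ OuterLam κ A μ, ∀ x, pot κ b x ≤ pot κ ν x

/-- The strong (energy) distance `‖μ − ν‖`. -/
noncomputable def strDist (κ : X → X → ℝ≥0∞) (μ ν : Measure X) : ℝ :=
  Real.sqrt ((energy κ μ μ).toReal - 2 * (energy κ μ ν).toReal + (energy κ ν ν).toReal)

/-- The energy principle (strict positive definiteness). -/
def EnergyPrinciple (κ : X → X → ℝ≥0∞) : Prop :=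
  ∀ μ ∈ Eplus κ, ∀ ν ∈ Eplus κ,
    2 * energy κ μ ν ≤ energy κ μ μ + energy κ ν ν ∧
      (2 * energy κ μ ν = energy κ μ μ + energy κ ν ν → μ = ν)

/-- Vague convergence of a net of measures along a filter. -/
def VagueConv {ι : Type*} (F : Filter ι) (m : ι → Measure X) (ν : Measure X) : Prop :=
  ∀ f : X → ℝ, Continuous f → HasCompactSupport f →
    Tendsto (fun i => ∫ x, f x ∂(m i)) F (nhds (∫ x, f x ∂ν))

/-- A net of measures is strong Cauchy (for the energy metric) along a filter. -/
def StrongCauchy (κ : X → X → ℝ≥0∞) {ι : Type*} (F : Filter ι) (m : ι → Measure X) : Prop :=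
  ∀ ε : ℝ, 0 < ε → ∃ s ∈ F, ∀ i ∈ s, ∀ j ∈ s, strDist κ (m i) (m j) < ε

/-- The consistency principle: every strong Cauchy net in `E⁺` converges strongly
to each of its vague limit points. -/
def Consistent (κ : X → X → ℝ≥0∞) : Prop :=
  ∀ (ι : Type) (F : Filter ι) (m : ι → Measure X), F.NeBot →
    (∀ i, m i ∈ Eplus κ) → StrongCauchy κ F m →
    ∀ ν : Measure X, (∃ G : Filter ι, G ≤ F ∧ G.NeBot ∧ VagueConv G m ν) →
      Tendsto (fun i => strDist κ (m i) ν) F (nhds 0)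

/-- The domination principle. -/
def Domination (κ : X → X → ℝ≥0∞) : Prop :=
  ∀ μ ∈ Eplus κ, ∀ ν ∈ Eplus κ,
    (∀ᵐ x ∂μ, pot κ μ x ≤ pot κ ν x) → ∀ x, pot κ μ x ≤ pot κ ν x

/-- A kernel: symmetric and lower semicontinuous. -/
structure IsKernel (κ : X → X → ℝ≥0∞) : Prop where
  symm : ∀ x y, κ x y = κ y x
  lsc : LowerSemicontinuous (Function.uncurry κ)

/-- `E'_A`: the strong closure of `E⁺_A` within `E⁺`. -/
def EclosOn (κ : X → X → ℝ≥0∞) (A : Set X) : Set (Measure X) :=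
  {ν ∈ Eplus κ | ∀ ε : ℝ, 0 < ε → ∃ μ ∈ EplusOn κ A, strDist κ ν μ < ε}

/-- The (real-valued) potential of the signed measure `λ = lp − lm`. -/
noncomputable def spot (κ : X → X → ℝ≥0∞) (lp lm : Measure X) (x : X) : ℝ :=
  (pot κ lp x).toReal - (pot κ lm x).toReal

/-- Assumption (A2): every `f ∈ C_c(X)` is the limit, uniformly with supports in one fixed
compact set, of a sequence of potentials of signed measures of finite energy that are
continuous and compactly supported. -/
def A2 (κ : X → X → ℝ≥0∞) : Prop :=
  ∀ f : X → ℝ, Continuous f → HasCompactSupport f →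
    ∃ (K : Set X) (lp lm : ℕ → Measure X), IsCompact K ∧ tsupport f ⊆ K ∧
      (∀ j, lp j ∈ Eplus κ ∧ lm j ∈ Eplus κ) ∧
      (∀ j x, pot κ (lp j) x ≠ ⊤ ∨ pot κ (lm j) x ≠ ⊤) ∧
      (∀ j, Continuous (spot κ (lp j) (lm j))) ∧
      (∀ j, tsupport (spot κ (lp j) (lm j)) ⊆ K) ∧
      TendstoUniformly (fun j => spot κ (lp j) (lm j)) f atTop

section LowerSemicontinuous

variable {Y : Type*} [TopologicalSpace Y]

/-- Monotone convergence for directed families of lower semicontinuous functions,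
without any countability restriction on the family. -/
theorem lintegral_iSup_of_lowerSemicontinuous [MeasurableSpace Y] [BorelSpace Y]
    {ι : Type*} [SemilatticeSup ι] [Nonempty ι] (ν : Measure Y) [ν.InnerRegular]
    {g : ι → Y → ℝ≥0∞} (hg : ∀ i, LowerSemicontinuous (g i)) (hm : Monotone g) :
    ∫⁻ y, ⨆ i, g i y ∂ν = ⨆ i, ∫⁻ y, g i y ∂ν := by
  refine le_antisymm ?_ (iSup_le fun i => lintegral_mono fun y => le_iSup (fun i => g i y) i)
  set S := ⨆ i, ∫⁻ y, g i y ∂ν with hS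
  by_cases hST : S = ⊤
  · simp [hST]
  obtain ⟨u, -, hu, hur⟩ := exists_seq_tendsto_sSup
    (range_nonempty fun i => ∫⁻ y, g i y ∂ν) (OrderTop.bddAbove _)
  choose j hj using hur
  let k : ℕ → ι := partialSups j
  have hkm : Monotone k := (partialSups j).monotone
  let h : Y → ℝ≥0∞ := fun y => ⨆ n, g (k n) y
  have hhm : Measurable h := Measurable.iSup fun n => (hg _).measurable
  have hSh : S ≤ ∫⁻ y, h y ∂ν := by
    refine le_of_tendsto' hu fun n => ?_
    rw [← hj n]
    exact lintegral_mono fun y =>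
      (hm (le_partialSups j n) y).trans (le_iSup (fun n => g (k n) y) n)
  have hmax (i : ι) : ∫⁻ y, g i y ⊔ h y ∂ν ≤ S := by
    have : ∀ y, g i y ⊔ h y = ⨆ n, g i y ⊔ g (k n) y := fun y => sup_iSup
    simp_rw [this]
    rw [lintegral_iSup (f := fun n y => g i y ⊔ g (k n) y)
      (fun n => (hg i).measurable.sup (hg _).measurable)
      (fun a b hab y => sup_le_sup_left (hm (hkm hab) y) _)]
    refine iSup_le fun n => le_trans ?_ (le_iSup (fun i => ∫⁻ y, g i y ∂ν) (i ⊔ k n))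
    exact lintegral_mono fun y => sup_le (hm le_sup_left y) (hm le_sup_right y)
  have hhS : ∫⁻ y, h y ∂ν ≤ S :=
    (lintegral_mono fun y => le_sup_right).trans (hmax (Classical.arbitrary ι))
  have hle (i : ι) : ∀ᵐ y ∂ν, g i y ≤ h y := by
    have := ae_eq_of_ae_le_of_lintegral_le (μ := ν) (f := h) (g := fun y => g i y ⊔ h y)
      (ae_of_all _ fun y => le_sup_right) (ne_top_of_le_ne_top hST hhS)
      ((hg i).measurable.sup hhm).aemeasurable ((hmax i).trans hSh)
    filter_upwards [this] with y hy
    rw [hy]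
    exact le_sup_left
  suffices hae : ∀ᵐ y ∂ν, ⨆ i, g i y ≤ h y from (lintegral_mono_ae hae).trans hhS
  have hq : ∀ q : ℚ,
      ν ({y | (Real.toNNReal q : ℝ≥0∞) < ⨆ i, g i y} ∩ {y | h y ≤ Real.toNNReal q}) = 0 := by
    intro q
    have hopen (i : ι) : IsOpen {y | (Real.toNNReal q : ℝ≥0∞) < g i y} := (hg i).isOpen_preimage _
    have hun : {y | (Real.toNNReal q : ℝ≥0∞) < ⨆ i, g i y} =
        ⋃ i, {y | (Real.toNNReal q : ℝ≥0∞) < g i y} := by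
      ext y
      simp [lt_iSup_iff]
    have hmeas : MeasurableSet
        ({y | (Real.toNNReal q : ℝ≥0∞) < ⨆ i, g i y} ∩ {y | h y ≤ Real.toNNReal q}) := by
      rw [hun]
      exact (isOpen_iUnion hopen).measurableSet.inter (measurableSet_le hhm measurable_const)
    rw [hmeas.measure_eq_iSup_isCompact]
    simp only [ENNReal.iSup_eq_zero]
    intro K hK hKc
    obtain ⟨i, hi⟩ := hKc.elim_directed_cover _ hopen (hun ▸ fun y hy => (hK hy).1)
      (directed_of_isDirected_le fun a b hab y hy => lt_of_lt_of_le hy (hm hab y))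
    refine measure_mono_null (fun y hy => ?_) (hle i)
    exact not_le.2 (lt_of_le_of_lt (hK hy).2 (mem_ofPred.1 (hi hy)))
  refine measure_mono_null (fun y hy => ?_) (measure_iUnion_null hq)
  obtain ⟨q, -, hq₁, hq₂⟩ := ENNReal.lt_iff_exists_rat_btwn.1 (not_le.1 hy)
  exact mem_iUnion.2 ⟨q, hq₂, hq₁.le⟩

/-- The compactly supported continuous functions below `g`. -/
abbrev CcBelow (g : Y → ℝ≥0∞) : Type _ :=
  {f : CompactlySupportedContinuousMap Y ℝ≥0 // ∀ y, (f y : ℝ≥0∞) ≤ g y}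

instance (g : Y → ℝ≥0∞) : SemilatticeSup (CcBelow g) :=
  Subtype.semilatticeSup fun f f' hf hf' y => by
    rcases le_total (f y) (f' y) with h | h
    · simpa [h] using hf' y
    · simpa [h] using hf y

instance (g : Y → ℝ≥0∞) : Nonempty (CcBelow g) := ⟨⟨0, fun y => by simp⟩⟩

theorem CcBelow.coe_mono {g : Y → ℝ≥0∞} {f f' : CcBelow g} (h : f ≤ f') (y : Y) :
    (f.1 y : ℝ≥0∞) ≤ f'.1 y :=
  ENNReal.coe_le_coe.2 (h y)

theorem iSup_ccBelow [T2Space Y] [LocallyCompactSpace Y] {g : Y → ℝ≥0∞}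
    (hg : LowerSemicontinuous g) (y : Y) : ⨆ f : CcBelow g, (f.1 y : ℝ≥0∞) = g y := by
  refine le_antisymm (iSup_le fun f => f.2 y) (le_of_forall_lt fun c hc => ?_)
  obtain ⟨r, hcr, hr⟩ := ENNReal.lt_iff_exists_nnreal_btwn.1 hc
  obtain ⟨φ, h1, h0, hφ, hφ01⟩ := exists_continuous_one_zero_of_isCompact
    (isCompact_singleton (x := y))
    (hg.isOpen_preimage r).isClosed_compl (by simpa using hr)
  let f : CompactlySupportedContinuousMap Y ℝ≥0 :=
    ⟨⟨fun z => r * (φ z).toNNReal, by fun_prop⟩,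
      hφ.comp_left (g := fun t : ℝ => r * t.toNNReal) (by simp)⟩
  have hf : ∀ z, (f z : ℝ≥0∞) ≤ g z := by
    intro z
    change ((r * (φ z).toNNReal : ℝ≥0) : ℝ≥0∞) ≤ g z
    by_cases hz : (r : ℝ≥0∞) < g z
    · refine le_trans ?_ hz.le
      exact_mod_cast mul_le_of_le_one_right' (Real.toNNReal_le_one.2 (hφ01 z).2)
    · have : φ z = 0 := h0 hz
      simp [this]
  refine hcr.trans_le (le_trans ?_ (le_iSup (fun f : CcBelow g => (f.1 y : ℝ≥0∞)) ⟨f, hf⟩))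
  have : φ y = 1 := h1 rfl
  change (r : ℝ≥0∞) ≤ ((r * (φ y).toNNReal : ℝ≥0) : ℝ≥0∞)
  simp [this]

theorem lintegral_eq_iSup_ccBelow [T2Space Y] [LocallyCompactSpace Y] [MeasurableSpace Y]
    [BorelSpace Y] (ν : Measure Y) [ν.InnerRegular] {g : Y → ℝ≥0∞} (hg : LowerSemicontinuous g) :
    ∫⁻ y, g y ∂ν = ⨆ f : CcBelow g, ∫⁻ y, f.1 y ∂ν := by
  simp_rw [← iSup_ccBelow hg]
  exact lintegral_iSup_of_lowerSemicontinuous ν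
    (fun f => (ENNReal.continuous_coe.comp f.1.continuous).lowerSemicontinuous)
    fun f f' h y => CcBelow.coe_mono h y

theorem lintegral_coe_eq_ofReal_integral [MeasurableSpace Y] [BorelSpace Y] (ν : Measure Y)
    [IsLocallyFiniteMeasure ν] {f : Y → ℝ≥0} (hf : Continuous f) (hfc : HasCompactSupport f) :
    ∫⁻ y, f y ∂ν = ENNReal.ofReal (∫ y, (f y : ℝ) ∂ν) := by
  have hs : HasCompactSupport fun y => (f y : ℝ) :=
    hfc.comp_left (g := fun t : ℝ≥0 => (t : ℝ)) rfl
  have hi : Integrable (fun y => (f y : ℝ)) ν :=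
    (NNReal.continuous_coe.comp hf).integrable_of_hasCompactSupport hs
  rw [ofReal_integral_eq_lintegral_ofReal hi (ae_of_all _ fun y => NNReal.coe_nonneg _)]
  simp

end LowerSemicontinuous

/-- Inner regular locally finite measures on a `σ`-compact space are determined by their
integrals of compactly supported continuous functions. -/
theorem IsRadon.ext [SigmaCompactSpace X] {μ ν : Measure X} (hμ : IsRadon μ) (hν : IsRadon ν)
    (h : ∀ f : X → ℝ, Continuous f → HasCompactSupport f → ∫ x, f x ∂μ = ∫ x, f x ∂ν) :
    μ = ν := by
  have := hμ.1
  have := hν.1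
  have := hμ.2
  have := hν.2
  have hopen : ∀ U : Set X, IsOpen U → μ U = ν U := by
    intro U hU
    have hlsc : LowerSemicontinuous (U.indicator (1 : X → ℝ≥0∞)) :=
      hU.lowerSemicontinuous_indicator zero_le_one
    rw [← lintegral_indicator_one hU.measurableSet, ← lintegral_indicator_one hU.measurableSet,
      lintegral_eq_iSup_ccBelow μ hlsc, lintegral_eq_iSup_ccBelow ν hlsc]
    congr! 2 with f
    have hc : Continuous fun x => (f.1 x : ℝ) := by fun_prop
    have hs : HasCompactSupport fun x => (f.1 x : ℝ) :=
      f.1.hasCompactSupport.comp_left (g := fun t : ℝ≥0 => (t : ℝ)) rfl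
    rw [lintegral_coe_eq_ofReal_integral μ (map_continuous f.1) f.1.hasCompactSupport,
      lintegral_coe_eq_ofReal_integral ν (map_continuous f.1) f.1.hasCompactSupport, h _ hc hs]
  exact μ.finiteSpanningSetsInOpen.ext BorelSpace.measurable_eq isPiSystem_isOpen hopen

theorem IsRadon.add {Y : Type*} [TopologicalSpace Y] [LocallyCompactSpace Y]
    [MeasurableSpace Y] {μ ν : Measure Y} (hμ : IsRadon μ) (hν : IsRadon ν) :
    IsRadon (μ + ν) := by
  obtain ⟨_, _⟩ := hμ
  obtain ⟨_, _⟩ := hν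
  have : IsFiniteMeasureOnCompacts (μ + ν) :=
    ⟨fun K hK => by simpa using ⟨hK.measure_lt_top, hK.measure_lt_top⟩⟩
  exact ⟨inferInstance, inferInstance⟩

theorem IsRadon.smul {Y : Type*} [TopologicalSpace Y] [MeasurableSpace Y]
    {μ : Measure Y} (hμ : IsRadon μ) (c : ℝ≥0) : IsRadon (c • μ) := by
  obtain ⟨_, _⟩ := hμ
  exact ⟨inferInstance, inferInstance⟩

theorem continuous_lintegral_prodMk {Y : Type*} [TopologicalSpace Y] [T2Space Y]
    [MeasurableSpace Y] [BorelSpace Y] (ν : Measure Y) [IsLocallyFiniteMeasure ν]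
    (f : CompactlySupportedContinuousMap (Y × Y) ℝ≥0) :
    Continuous fun x => ∫⁻ y, (f (x, y) : ℝ≥0∞) ∂ν := by
  have hc : Continuous fun p => (f p : ℝ) := by fun_prop
  have hk : IsCompact (Prod.snd '' tsupport f) := f.hasCompactSupport.image continuous_snd
  have hz : ∀ x y, y ∉ Prod.snd '' tsupport f → f (x, y) = 0 := fun x y hy =>
    image_eq_zero_of_notMem_tsupport fun h => hy ⟨(x, y), h, rfl⟩
  have hcont : Continuous fun x => ∫ y, (f (x, y) : ℝ) ∂ν := by
    rw [← continuousOn_univ]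
    exact continuousOn_integral_of_compact_support hk hc.continuousOn fun x y _ hy => by
      simp [hz x y hy]
  have hint (x : Y) : ∫⁻ y, (f (x, y) : ℝ≥0∞) ∂ν = ENNReal.ofReal (∫ y, (f (x, y) : ℝ) ∂ν) :=
    lintegral_coe_eq_ofReal_integral ν (by fun_prop) (HasCompactSupport.intro hk (hz x))
  simp_rw [hint]
  exact ENNReal.continuous_ofReal.comp hcont

namespace IsKernel

variable {κ : X → X → ℝ≥0∞}

theorem pot_eq_iSup (hκ : IsKernel κ) (ν : Measure X) [ν.InnerRegular] (x : X) :
    pot κ ν x = ⨆ f : CcBelow (Function.uncurry κ), ∫⁻ y, f.1 (x, y) ∂ν := by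
  have : ∀ y, κ x y = ⨆ f : CcBelow (Function.uncurry κ), (f.1 (x, y) : ℝ≥0∞) :=
    fun y => (iSup_ccBelow hκ.lsc (x, y)).symm
  simp_rw [pot, this]
  exact lintegral_iSup_of_lowerSemicontinuous ν
    (fun f => Continuous.lowerSemicontinuous (by fun_prop))
    fun f f' h y => CcBelow.coe_mono h (x, y)

theorem lowerSemicontinuous_pot (hκ : IsKernel κ) {ν : Measure X} (hν : IsRadon ν) :
    LowerSemicontinuous (pot κ ν) := by
  obtain ⟨_, _⟩ := hν
  rw [funext (hκ.pot_eq_iSup ν)]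
  exact lowerSemicontinuous_iSup fun f =>
    (continuous_lintegral_prodMk ν f.1).lowerSemicontinuous

theorem energy_eq_iSup (hκ : IsKernel κ) {μ ν : Measure X} (hμ : IsRadon μ) (hν : IsRadon ν) :
    energy κ μ ν = ⨆ f : CcBelow (Function.uncurry κ), ∫⁻ x, ∫⁻ y, f.1 (x, y) ∂ν ∂μ := by
  obtain ⟨_, _⟩ := hμ
  obtain ⟨_, _⟩ := hν
  simp_rw [energy, hκ.pot_eq_iSup ν]
  exact lintegral_iSup_of_lowerSemicontinuous μ
    (fun f => (continuous_lintegral_prodMk ν f.1).lowerSemicontinuous)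
    fun f f' h x => lintegral_mono fun y => CcBelow.coe_mono h (x, y)

/-- The mutual energy of Radon measures is symmetric. -/
theorem energy_comm [SigmaCompactSpace X] (hκ : IsKernel κ) {μ ν : Measure X} (hμ : IsRadon μ)
    (hν : IsRadon ν) : energy κ μ ν = energy κ ν μ := by
  have hle : ∀ {μ ν : Measure X}, IsRadon μ → IsRadon ν → energy κ μ ν ≤ energy κ ν μ := by
    intro μ ν hμ hν
    rw [hκ.energy_eq_iSup hμ hν]
    have := hμ.2
    have := hν.2
    refine iSup_le fun f => ?_
    have hf : Measurable fun p : X × X => (f.1 p : ℝ≥0∞) :=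
      (f.1.hasCompactSupport.measurable_of_prod f.1.continuous).coe_nnreal_ennreal
    rw [lintegral_lintegral_swap (f := fun x y => (f.1 (x, y) : ℝ≥0∞)) hf.aemeasurable]
    exact lintegral_mono fun y => lintegral_mono fun x => (f.2 (x, y)).trans_eq (hκ.symm x y)
  exact (hle hμ hν).antisymm (hle hν hμ)

end IsKernel

section Bilinear

variable {κ : X → X → ℝ≥0∞} {μ ν ρ : Measure X}

theorem energy_add_left {Y : Type*} [MeasurableSpace Y] {κ : Y → Y → ℝ≥0∞}
    {μ ν ρ : Measure Y} : energy κ (μ + ν) ρ = energy κ μ ρ + energy κ ν ρ :=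
  lintegral_add_measure _ _ _

theorem energy_smul_left {Y : Type*} [MeasurableSpace Y] {κ : Y → Y → ℝ≥0∞}
    {μ ν : Measure Y} (c : ℝ≥0) : energy κ (c • μ) ν = c * energy κ μ ν :=
  lintegral_smul_measure _ _

theorem energy_add_right (hκ : IsKernel κ) (hν : IsRadon ν) :
    energy κ μ (ν + ρ) = energy κ μ ν + energy κ μ ρ := by
  simp_rw [energy, pot, lintegral_add_measure]
  exact lintegral_add_left (hκ.lowerSemicontinuous_pot hν).measurable _

theorem energy_smul_right (hκ : IsKernel κ) (hν : IsRadon ν) (c : ℝ≥0) :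
    energy κ μ (c • ν) = c * energy κ μ ν := by
  have : pot κ (c • ν) = fun x => c * pot κ ν x := funext fun x => lintegral_smul_measure _ _
  rw [energy, this]
  exact lintegral_const_mul _ (hκ.lowerSemicontinuous_pot hν).measurable

end Bilinear

section PositiveDefinite

variable {κ : X → X → ℝ≥0∞}

theorem energy_ne_top_of_posDef {Y : Type*} [TopologicalSpace Y] [MeasurableSpace Y]
    {κ : Y → Y → ℝ≥0∞}
    (hpd : ∀ μ ∈ Eplus κ, ∀ ν ∈ Eplus κ, 2 * energy κ μ ν ≤ energy κ μ μ + energy κ ν ν)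
    {μ ν : Measure Y} (hμ : μ ∈ Eplus κ) (hν : ν ∈ Eplus κ) : energy κ μ ν ≠ ⊤ := by
  intro h
  have := (hpd μ hμ ν hν).trans_lt (ENNReal.add_lt_top.2 ⟨hμ.2, hν.2⟩)
  simp [h] at this

variable [SigmaCompactSpace X]

theorem energy_le_of_energy_eq (hκ : IsKernel κ)
    (hpd : ∀ μ ∈ Eplus κ, ∀ ν ∈ Eplus κ, 2 * energy κ μ ν ≤ energy κ μ μ + energy κ ν ν)
    {μ ν ρ : Measure X} (hμ : μ ∈ Eplus κ) (hν : ν ∈ Eplus κ) (hρ : ρ ∈ Eplus κ)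
    (h : energy κ μ μ + energy κ ν ν = 2 * energy κ μ ν) :
    energy κ ν ρ ≤ energy κ μ ρ := by
  have hfin {σ τ : Measure X} (hσ : σ ∈ Eplus κ) (hτ : τ ∈ Eplus κ) :=
    energy_ne_top_of_posDef hpd hσ hτ
  refine (ENNReal.toReal_le_toReal (hfin hν hρ) (hfin hμ hρ)).1 ?_
  have key : ∀ t : ℝ≥0, 0 < t → (energy κ ν ρ).toReal ≤
      (energy κ μ ρ).toReal + t / 2 * (energy κ ρ ρ).toReal := by
    intro t ht
    have hexp : energy κ (μ + t • ρ) (μ + t • ρ) =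
        energy κ μ μ + 2 * (t * energy κ μ ρ) + t * (t * energy κ ρ ρ) := by
      rw [energy_add_right hκ hμ.1, energy_smul_right hκ hρ.1, energy_add_left, energy_add_left,
        energy_smul_left, energy_smul_left, hκ.energy_comm hρ.1 hμ.1]
      ring
    have hmem : μ + t • ρ ∈ Eplus κ := by
      refine ⟨hμ.1.add (hρ.1.smul t), ?_⟩
      rw [hexp, lt_top_iff_ne_top]
      finiteness [hfin hμ hμ, hfin hμ hρ, hfin hρ hρ]
    have hle := hpd _ hmem ν hν
    rw [hexp, energy_add_left, energy_smul_left, hκ.energy_comm hρ.1 hν.1] at hle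
    lift energy κ μ μ to ℝ≥0 using hfin hμ hμ with a
    lift energy κ ν ν to ℝ≥0 using hfin hν hν with b
    lift energy κ ρ ρ to ℝ≥0 using hfin hρ hρ with c
    lift energy κ μ ν to ℝ≥0 using hfin hμ hν with d
    lift energy κ μ ρ to ℝ≥0 using hfin hμ hρ with e
    lift energy κ ν ρ to ℝ≥0 using hfin hν hρ with f
    norm_cast at hle h
    have hle' : 2 * ((d : ℝ) + t * f) ≤ a + 2 * (t * e) + t * (t * c) + b := by exact_mod_cast hle
    have h' : (a : ℝ) + b = 2 * d := by exact_mod_cast h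
    have ht' : (0 : ℝ) < t := ht
    simp only [ENNReal.coe_toReal]
    refine le_of_mul_le_mul_left ?_ ht'
    linarith
  have hlim : Tendsto (fun t : ℝ≥0 => (energy κ μ ρ).toReal + t / 2 * (energy κ ρ ρ).toReal)
      (𝓝[>] 0) (𝓝 ((energy κ μ ρ).toReal)) := by
    refine tendsto_nhdsWithin_of_tendsto_nhds ?_
    refine Continuous.tendsto' (by fun_prop) _ _ (by simp)
  exact ge_of_tendsto hlim (eventually_mem_nhdsWithin.mono key)

theorem energy_eq_of_energy_eq (hκ : IsKernel κ)
    (hpd : ∀ μ ∈ Eplus κ, ∀ ν ∈ Eplus κ, 2 * energy κ μ ν ≤ energy κ μ μ + energy κ ν ν)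
    {μ ν ρ : Measure X} (hμ : μ ∈ Eplus κ) (hν : ν ∈ Eplus κ) (hρ : ρ ∈ Eplus κ)
    (h : energy κ μ μ + energy κ ν ν = 2 * energy κ μ ν) :
    energy κ μ ρ = energy κ ν ρ :=
  le_antisymm
    (energy_le_of_energy_eq hκ hpd hν hμ hρ (by rw [add_comm, h, hκ.energy_comm hμ.1 hν.1]))
    (energy_le_of_energy_eq hκ hpd hμ hν hρ h)

end PositiveDefinite

theorem IsKernel.integral_spot {κ : X → X → ℝ≥0∞} (hκ : IsKernel κ) {μ lp lm : Measure X}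
    (hlp : IsRadon lp) (hlm : IsRadon lm) (hp : energy κ μ lp ≠ ⊤) (hm : energy κ μ lm ≠ ⊤) :
    ∫ x, spot κ lp lm x ∂μ = (energy κ μ lp).toReal - (energy κ μ lm).toReal := by
  have hpm := (hκ.lowerSemicontinuous_pot hlp).measurable
  have hmm := (hκ.lowerSemicontinuous_pot hlm).measurable
  have hcalc {f : X → ℝ≥0∞} (hf : Measurable f) (hfi : ∫⁻ x, f x ∂μ ≠ ⊤) :
      ∫ x, (f x).toReal ∂μ = (∫⁻ x, f x ∂μ).toReal :=
    integral_toReal hf.aemeasurable (ae_lt_top hf hfi)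
  simp only [spot]
  rw [integral_sub (integrable_toReal_of_lintegral_ne_top hpm.aemeasurable hp)
    (integrable_toReal_of_lintegral_ne_top hmm.aemeasurable hm), hcalc hpm hp, hcalc hmm hm]
  rfl

/-- Integrals of continuous functions converging uniformly, with supports in a fixed compact
set, converge. -/
theorem tendsto_integral_of_tendstoUniformly_of_tsupport_subset {Y : Type*}
    [TopologicalSpace Y] [T2Space Y] [MeasurableSpace Y] [BorelSpace Y] (μ : Measure Y)
    [IsLocallyFiniteMeasure μ] {K : Set Y} (hK : IsCompact K) {F : ℕ → Y → ℝ} {f : Y → ℝ}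
    (hF : ∀ j, Continuous (F j)) (hFK : ∀ j, tsupport (F j) ⊆ K) (hf : Continuous f)
    (hfK : tsupport f ⊆ K) (h : TendstoUniformly F f atTop) :
    Tendsto (fun j => ∫ x, F j x ∂μ) atTop (𝓝 (∫ x, f x ∂μ)) := by
  have hfc : HasCompactSupport f := hK.of_isClosed_subset (isClosed_tsupport f) hfK
  refine tendsto_integral_filter_of_dominated_convergence
    (fun x => |f x| + K.indicator (fun _ => (1 : ℝ)) x)
    (Eventually.of_forall fun j => ((hF j).integrable_of_hasCompactSupport
      (hK.of_isClosed_subset (isClosed_tsupport _) (hFK j))).aestronglyMeasurable) ?_ ?_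
    (ae_of_all _ fun x => h.tendsto_at x)
  · filter_upwards [Metric.tendstoUniformly_iff.1 h 1 one_pos] with j hj
    refine ae_of_all _ fun x => ?_
    by_cases hx : x ∈ K
    · have := hj x
      rw [Real.dist_eq] at this
      rw [indicator_of_mem hx, Real.norm_eq_abs]
      have h2 := abs_sub_abs_le_abs_sub (F j x) (f x)
      rw [abs_sub_comm] at h2
      linarith
    · rw [image_eq_zero_of_notMem_tsupport fun hx' => hx (hFK j hx')]
      simp [hx]
  · exact (hf.integrable_of_hasCompactSupport hfc).abs.add
      ((integrable_indicator_iff hK.measurableSet).2 (integrableOn_const hK.measure_ne_top))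

/-- A positive definite kernel satisfying (A2) on a σ-compact space is strictly
positive definite. -/
theorem statement18 [SigmaCompactSpace X] (κ : X → X → ℝ≥0∞) (hker : IsKernel κ)
    (hpd : ∀ μ ∈ Eplus κ, ∀ ν ∈ Eplus κ, 2 * energy κ μ ν ≤ energy κ μ μ + energy κ ν ν)
    (hA2 : A2 κ) :
    ∀ μ ∈ Eplus κ, ∀ ν ∈ Eplus κ,
      energy κ μ μ + energy κ ν ν = 2 * energy κ μ ν → μ = ν := by
  intro μ hμ ν hν h
  have := hμ.1.2
  have := hν.1.2
  refine hμ.1.ext hν.1 fun f hf hfc => ?_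
  obtain ⟨K, lp, lm, hK, hfK, hmem, -, hcont, hsupp, hlim⟩ := hA2 f hf hfc
  have heq : ∀ j, ∫ x, spot κ (lp j) (lm j) x ∂μ = ∫ x, spot κ (lp j) (lm j) x ∂ν := by
    intro j
    obtain ⟨hlp, hlm⟩ := hmem j
    rw [hker.integral_spot hlp.1 hlm.1 (energy_ne_top_of_posDef hpd hμ hlp)
        (energy_ne_top_of_posDef hpd hμ hlm),
      hker.integral_spot hlp.1 hlm.1 (energy_ne_top_of_posDef hpd hν hlp)
        (energy_ne_top_of_posDef hpd hν hlm),
      energy_eq_of_energy_eq hker hpd hμ hν hlp h, energy_eq_of_energy_eq hker hpd hμ hν hlm h]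
  have hμlim := tendsto_integral_of_tendstoUniformly_of_tsupport_subset μ hK hcont hsupp hf hfK hlim
  have hνlim := tendsto_integral_of_tendstoUniformly_of_tsupport_subset ν hK hcont hsupp hf hfK hlim
  exact tendsto_nhds_unique (hμlim.congr heq) hνlim

end Balayage
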